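/- Assume in addition that V_1^n = Ṽ_1^{n+1} = 1/‖ 1 ‖, V_{1+s}^n = Ṽ_{1+s}^{n+1} = v_s/‖ v_s ‖ for all s ∈ {1,…,d}, and V_{d+2}^n = Ṽ_{d+2}^{n+1} = (|v|² − 1)/‖ |v|² − 1 ‖ (so r ≥ d+2), and let E^{n+1} : Ω_x → ℝ^d be a further smooth field. Define the energy densities e^n = (1/2) ∫_{ℝ^d} |v|² f^n dv + (1/2)|E^n|² and e^{n+1} = (1/2)( ‖ |v|² − 1 ‖ · Σ_k X̃_k^{n+1} S̃^{n+1}_{k,d+2} + ‖ 1 ‖ · Σ_k X̃_k^{n+1} S̃^{n+1}_{k,1} ) + (1/2)|E^{n+1}|², and the energy flux Q^n = (1/2) ∫_{ℝ^d} v |v|² f^n dv. Then the discrete energy continuity equation (e^{n+1} − e^n)/τ + ∇_x · Q^n − E^n · ( (E^{n+1} − E^n)/τ − j^n ) = |E^{n+1} − E^n|²/(2τ) holds pointwise on Ω_x. -/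

import Mathlib

open MeasureTheory Real Set

noncomputable section

/-- Partial derivative of `u` in the `i`-th coordinate direction. -/
def pd {d : ℕ} (i : Fin d) (u : (Fin d → ℝ) → ℝ) (x : Fin d → ℝ) : ℝ :=
  fderiv ℝ u x (Pi.single i 1)

/-- Gaussian weight `f_{0v}(v) = exp(-|v|²/2)`. -/
def f0v {d : ℕ} (v : Fin d → ℝ) : ℝ := Real.exp (-(∑ i, v i ^ 2) / 2)

/-- Fundamental domain of the `d`-dimensional torus `Ω_x`. -/
def cube (d : ℕ) : Set (Fin d → ℝ) := Set.univ.pi fun _ => Set.Ioc (0 : ℝ) 1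

/-- `L²(Ω_x)` inner product. -/
def ipx {d : ℕ} (u w : (Fin d → ℝ) → ℝ) : ℝ := ∫ x in cube d, u x * w x

/-- Weighted inner product `⟨u,w⟩_v = ∫ f_{0v} u w dv`. -/
def ipv {d : ℕ} (u w : (Fin d → ℝ) → ℝ) : ℝ := ∫ v, f0v v * u v * w v

/-- Weighted norm `‖w‖ = ⟨w,w⟩_v^{1/2}`. -/
def nv {d : ℕ} (w : (Fin d → ℝ) → ℝ) : ℝ := Real.sqrt (ipv w w)

/-- Periodicity with period 1 in each coordinate (functions on the torus). -/
def Per {d : ℕ} (u : (Fin d → ℝ) → ℝ) : Prop := ∀ x i, u (x + Pi.single i 1) = u x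

/-- All (iterated) derivatives have at most polynomial growth. -/
def PolyAll {d : ℕ} (g : (Fin d → ℝ) → ℝ) : Prop :=
  ∀ n : ℕ, ∃ (C : ℝ) (p : ℕ), ∀ v, ‖iteratedFDeriv ℝ n g v‖ ≤ C * (1 + ‖v‖) ^ p

/-- Continuous functions bounded by a polynomial in the norm. -/
structure PolyGrowth {d : ℕ} (g : (Fin d → ℝ) → ℝ) : Prop where
  continuous : Continuous g
  bound : ∃ (C : ℝ) (p : ℕ), ∀ v, |g v| ≤ C * (1 + ‖v‖) ^ p

namespace PolyGrowth

variable {d : ℕ} {g h : (Fin d → ℝ) → ℝ}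

theorem const (c : ℝ) : PolyGrowth fun _ : Fin d → ℝ => c :=
  ⟨continuous_const, |c|, 0, by simp⟩

theorem coord (s : Fin d) : PolyGrowth fun v : Fin d → ℝ => v s := by
  refine ⟨continuous_apply s, 1, 1, fun v => ?_⟩
  have := norm_le_pi_norm v s
  rw [Real.norm_eq_abs] at this
  linarith

theorem add (hg : PolyGrowth g) (hh : PolyGrowth h) : PolyGrowth fun v => g v + h v := by
  obtain ⟨C, p, hC⟩ := hg.bound
  obtain ⟨D, q, hD⟩ := hh.bound
  refine ⟨hg.continuous.add hh.continuous, |C| + |D|, p + q, fun v => ?_⟩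
  have h1 : 1 ≤ 1 + ‖v‖ := by linarith [norm_nonneg v]
  have hp : (1 + ‖v‖) ^ p ≤ (1 + ‖v‖) ^ (p + q) := pow_le_pow_right₀ h1 (by omega)
  have hq : (1 + ‖v‖) ^ q ≤ (1 + ‖v‖) ^ (p + q) := pow_le_pow_right₀ h1 (by omega)
  calc |g v + h v| ≤ |g v| + |h v| := abs_add_le _ _
    _ ≤ |C| * (1 + ‖v‖) ^ p + |D| * (1 + ‖v‖) ^ q := by
      gcongr
      · exact (hC v).trans (by gcongr; exact le_abs_self C)
      · exact (hD v).trans (by gcongr; exact le_abs_self D)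
    _ ≤ |C| * (1 + ‖v‖) ^ (p + q) + |D| * (1 + ‖v‖) ^ (p + q) := by gcongr
    _ = (|C| + |D|) * (1 + ‖v‖) ^ (p + q) := by ring

theorem mul (hg : PolyGrowth g) (hh : PolyGrowth h) : PolyGrowth fun v => g v * h v := by
  obtain ⟨C, p, hC⟩ := hg.bound
  obtain ⟨D, q, hD⟩ := hh.bound
  refine ⟨hg.continuous.mul hh.continuous, C * D, p + q, fun v => ?_⟩
  rw [abs_mul, pow_add, mul_mul_mul_comm]
  exact mul_le_mul (hC v) (hD v) (abs_nonneg _) ((abs_nonneg _).trans (hC v))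

theorem neg (hg : PolyGrowth g) : PolyGrowth fun v => -g v := by
  simpa using (const (-1)).mul hg

theorem sub (hg : PolyGrowth g) (hh : PolyGrowth h) : PolyGrowth fun v => g v - h v := by
  simpa [sub_eq_add_neg] using hg.add hh.neg

theorem sum {ι : Type*} (t : Finset ι) {g : ι → (Fin d → ℝ) → ℝ} (hg : ∀ i, PolyGrowth (g i)) :
    PolyGrowth fun v => ∑ i ∈ t, g i v := by
  classical
  induction t using Finset.induction_on with
  | empty => simpa using const (d := d) 0
  | insert a t ha ih => simpa [Finset.sum_insert ha] using (hg a).add ih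

theorem sq_norm : PolyGrowth fun v : Fin d → ℝ => ∑ i, v i ^ 2 := by
  simpa only [pow_two] using sum Finset.univ fun i => (coord i).mul (coord i)

theorem of_polyAll (hg : ContDiff ℝ (⊤ : ℕ∞) g) (hp : PolyAll g) : PolyGrowth g := by
  obtain ⟨C, p, hC⟩ := hp 0
  exact ⟨hg.continuous, C, p, fun v => by simpa using hC v⟩

theorem pd_of_polyAll (hg : ContDiff ℝ (⊤ : ℕ∞) g) (hp : PolyAll g) (s : Fin d) :
    PolyGrowth (pd s g) := by
  obtain ⟨C, p, hC⟩ := hp 1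
  refine ⟨(hg.continuous_fderiv (by simp)).clm_apply continuous_const, C, p, fun v => ?_⟩
  refine le_trans ?_ (hC v)
  rw [norm_iteratedFDeriv_one]
  simpa [pd, Pi.norm_single] using (fderiv ℝ g v).le_opNorm (Pi.single s 1)

theorem continuous_f0v : Continuous (f0v (d := d)) := by
  unfold f0v
  fun_prop

/-- Polynomially growing functions are integrable against the Gaussian weight. -/
theorem integrable (hg : PolyGrowth g) : Integrable fun v => f0v v * g v := by
  obtain ⟨C, p, hC⟩ := hg.bound
  have hgauss : Integrable fun v : Fin d → ℝ => Real.exp (-(∑ i, v i ^ 2) / 4) := by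
    have := Integrable.fintype_prod (ι := Fin d) (μ := fun _ => volume)
      (f := fun _ => fun x : ℝ => Real.exp (-(1 / 4) * x ^ 2))
      fun _ => integrable_exp_neg_mul_sq (by norm_num)
    refine this.congr (ae_of_all _ fun v => ?_)
    simp only [← Real.exp_sum, ← Finset.mul_sum]
    ring_nf
  refine (hgauss.const_mul (|C| * (p.factorial * Real.exp 2))).mono'
    (continuous_f0v.mul hg.continuous).aestronglyMeasurable (ae_of_all _ fun v => ?_)
  have hnorm : ‖v‖ ^ 2 ≤ ∑ i, v i ^ 2 := by
    have : ‖v‖ ≤ √(∑ i, v i ^ 2) := by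
      refine (pi_norm_le_iff_of_nonneg (Real.sqrt_nonneg _)).2 fun i => ?_
      rw [Real.norm_eq_abs]
      exact Real.abs_le_sqrt
        (Finset.single_le_sum (f := fun i => v i ^ 2) (fun i _ => sq_nonneg _) (Finset.mem_univ i))
    exact (Real.le_sqrt (norm_nonneg _)
      (Finset.sum_nonneg fun i _ => sq_nonneg _)).1 this
  have hpow : (1 + ‖v‖) ^ p ≤ p.factorial * Real.exp 2 * Real.exp ((∑ i, v i ^ 2) / 4) := by
    have h1 := Real.pow_div_factorial_le_exp (1 + ‖v‖) (by positivity) p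
    rw [div_le_iff₀ (by positivity)] at h1
    rw [mul_assoc, ← Real.exp_add]
    refine h1.trans ?_
    rw [mul_comm]
    refine mul_le_mul_of_nonneg_left (Real.exp_le_exp.2 ?_) (by positivity)
    nlinarith [sq_nonneg (‖v‖ - 2)]
  have hexp : f0v v * Real.exp ((∑ i, v i ^ 2) / 4) = Real.exp (-(∑ i, v i ^ 2) / 4) := by
    rw [f0v, ← Real.exp_add]
    ring_nf
  have hpos : 0 < f0v v := Real.exp_pos _
  rw [Real.norm_eq_abs, abs_mul, abs_of_pos hpos, ← hexp]
  calc f0v v * |g v| ≤ f0v v * (|C| * (1 + ‖v‖) ^ p) := by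
        gcongr
        exact (hC v).trans (by gcongr; exact le_abs_self C)
    _ ≤ f0v v * (|C| * (p.factorial * Real.exp 2 * Real.exp ((∑ i, v i ^ 2) / 4))) := by gcongr
    _ = _ := by ring

theorem integrable_mul (hg : PolyGrowth g) (hh : PolyGrowth h) :
    Integrable fun v => g v * (f0v v * h v) :=
  (hg.mul hh).integrable.congr (ae_of_all _ fun v => by ring)

/-- Moments of a Gaussian-weighted expansion are computed term by term. -/
theorem integral_mul_sum {ι : Type*} [Fintype ι] {W : ι → (Fin d → ℝ) → ℝ}
    (hg : PolyGrowth g) (hW : ∀ j, PolyGrowth (W j)) (a : ι → ℝ) :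
    ∫ v, g v * (f0v v * ∑ j, a j * W j v) = ∑ j, a j * ∫ v, g v * (f0v v * W j v) := by
  simp_rw [← integral_const_mul]
  rw [← integral_finsetSum _ fun j _ => (hg.integrable_mul (hW j)).const_mul (a j)]
  refine integral_congr_ae (ae_of_all _ fun v => ?_)
  simp only [Finset.mul_sum]
  exact Finset.sum_congr rfl fun j _ => by ring

end PolyGrowth

section

variable {d : ℕ}

theorem hasFDerivAt_sq_norm (v : Fin d → ℝ) :
    HasFDerivAt (fun v : Fin d → ℝ => ∑ i, v i ^ 2)
      (∑ i, (2 * v i) • ContinuousLinearMap.proj (R := ℝ) (φ := fun _ : Fin d => ℝ) i) v := by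
  refine HasFDerivAt.fun_sum fun i _ => ?_
  simpa using (hasFDerivAt_apply (𝕜 := ℝ) i v).pow 2

theorem pd_sq_norm (s : Fin d) (v : Fin d → ℝ) :
    pd s (fun v : Fin d → ℝ => ∑ i, v i ^ 2) v = 2 * v s := by
  rw [pd, (hasFDerivAt_sq_norm v).fderiv]
  simp [Pi.single_apply]

theorem hasFDerivAt_f0v (v : Fin d → ℝ) :
    HasFDerivAt f0v (f0v v • (-(1 / 2 : ℝ)) •
      ∑ i, (2 * v i) • ContinuousLinearMap.proj (R := ℝ) (φ := fun _ : Fin d => ℝ) i) v := by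
  have := ((hasFDerivAt_sq_norm v).const_mul (-(1 / 2 : ℝ))).exp
  refine (this.congr_of_eventuallyEq (Filter.Eventually.of_forall fun w => ?_)).congr_fderiv ?_
  · simp only [f0v]; ring_nf
  · simp only [f0v]; ring_nf

theorem pd_f0v_mul {h : (Fin d → ℝ) → ℝ} (hh : Differentiable ℝ h) (s : Fin d) (v : Fin d → ℝ) :
    pd s (fun v => f0v v * h v) v = f0v v * (pd s h v - v s * h v) := by
  rw [pd, ((hasFDerivAt_f0v v).fun_mul (hh v).hasFDerivAt).fderiv]
  simp [Pi.single_apply, pd]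
  ring

theorem pd_sum_mul {ι : Type*} [Fintype ι] {W : ι → (Fin d → ℝ) → ℝ}
    (hW : ∀ j, Differentiable ℝ (W j)) (b : ι → ℝ) (s : Fin d) (x : Fin d → ℝ) :
    pd s (fun y => ∑ j, W j y * b j) x = ∑ j, pd s (W j) x * b j := by
  have := HasFDerivAt.fun_sum (u := Finset.univ)
    fun j _ => ((hW j) x).hasFDerivAt.mul_const (b j)
  rw [pd, this.fderiv]
  simp [pd, mul_comm]

theorem pd_const_mul {h : (Fin d → ℝ) → ℝ} (hh : Differentiable ℝ h) (c : ℝ) (s : Fin d)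
    (x : Fin d → ℝ) : pd s (fun y => c * h y) x = c * pd s h x := by
  rw [pd, ((hh x).hasFDerivAt.const_mul c).fderiv]
  simp [pd]

/-- Integration by parts of `|v|²` against a Gaussian-weighted function. -/
theorem integral_sq_norm_mul_pd {h : (Fin d → ℝ) → ℝ} (hd : Differentiable ℝ h)
    (hh : PolyGrowth h) (s : Fin d) (hh' : PolyGrowth (pd s h)) :
    ∫ v, (∑ i, v i ^ 2) * pd s (fun v => f0v v * h v) v = -(2 * ∫ v, v s * (f0v v * h v)) := by
  have hder : Differentiable ℝ fun v => f0v v * h v := fun v =>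
    (hasFDerivAt_f0v v).differentiableAt.mul (hd v)
  have key := integral_mul_fderiv_eq_neg_fderiv_mul_of_integrable (μ := volume)
    (f := fun v : Fin d → ℝ => ∑ i, v i ^ 2) (g := fun v => f0v v * h v) (v := Pi.single s 1)
    (((((PolyGrowth.const 2).mul (PolyGrowth.coord s))).integrable_mul hh).congr
      (ae_of_all _ fun v => congrArg (· * (f0v v * h v)) (pd_sq_norm s v).symm))
    ((PolyGrowth.sq_norm.integrable_mul (hh'.sub ((PolyGrowth.coord s).mul hh))).congr
      (ae_of_all _ fun v =>
        congrArg ((∑ i, v i ^ 2) * ·) (pd_f0v_mul hd s v).symm))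
    (PolyGrowth.sq_norm.integrable_mul hh)
    (fun v _ => (hasFDerivAt_sq_norm v).differentiableAt) (fun v _ => hder v)
  refine key.trans ?_
  rw [← integral_const_mul]
  congr 2
  funext v
  have := pd_sq_norm s v
  rw [pd] at this
  rw [this, mul_assoc]

theorem integrableOn_cube {u : (Fin d → ℝ) → ℝ} (hu : Continuous u) :
    IntegrableOn u (cube d) := by
  have hsub : cube d ⊆ Set.Icc 0 1 := fun x hx =>
    ⟨fun i => (hx i (Set.mem_univ i)).1.le, fun i => (hx i (Set.mem_univ i)).2⟩
  exact (hu.continuousOn.integrableOn_compact isCompact_Icc).mono_set hsub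

theorem integrableOn_cube_mul {u w : (Fin d → ℝ) → ℝ} (hu : Continuous u) (hw : Continuous w) :
    IntegrableOn (fun x => u x * w x) (cube d) :=
  integrableOn_cube (hu.mul hw)

theorem ipx_add_const_mul {u w z : (Fin d → ℝ) → ℝ} (hu : Continuous u) (hw : Continuous w)
    (hz : Continuous z) (c : ℝ) :
    ipx u (fun x => w x + c * z x) = ipx u w + c * ipx u z := by
  simp only [ipx]
  rw [← integral_const_mul, ← integral_add (integrableOn_cube_mul hu hw)
    ((integrableOn_cube_mul hu hz).const_mul c)]
  congr 1
  funext x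
  ring

theorem ipx_sum {ι : Type*} [Fintype ι] {u : (Fin d → ℝ) → ℝ} {W : ι → (Fin d → ℝ) → ℝ}
    (hu : Continuous u) (hW : ∀ i, Continuous (W i)) (a : ι → ℝ) :
    ipx u (fun x => ∑ i, W i x * a i) = ∑ i, ipx u (W i) * a i := by
  simp only [ipx]
  simp_rw [← integral_mul_const]
  rw [← integral_finsetSum _ fun i _ => (integrableOn_cube_mul hu (hW i)).mul_const (a i)]
  congr 1
  funext x
  rw [Finset.mul_sum]
  exact Finset.sum_congr rfl fun i _ => by ring

theorem continuous_of_mem_span {ι : Type*} [Fintype ι] {W : ι → (Fin d → ℝ) → ℝ}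
    (hW : ∀ i, Continuous (W i)) {u : (Fin d → ℝ) → ℝ}
    (hu : u ∈ Submodule.span ℝ (Set.range W)) : Continuous u := by
  obtain ⟨c, rfl⟩ := (Submodule.mem_span_range_iff_exists_fun ℝ).1 hu
  rw [Finset.sum_fn]
  exact continuous_finsetSum _ fun i _ => (hW i).const_smul (c i)

/-- Orthonormal expansion of an element of the span. -/
theorem sum_mul_ipx_of_mem_span {ι : Type*} [Fintype ι] [DecidableEq ι]
    {W : ι → (Fin d → ℝ) → ℝ} (hW : ∀ i, Continuous (W i))
    (hon : ∀ k l, ipx (W k) (W l) = if k = l then (1 : ℝ) else 0) {u : (Fin d → ℝ) → ℝ}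
    (hu : u ∈ Submodule.span ℝ (Set.range W)) (x : Fin d → ℝ) :
    ∑ k, W k x * ipx (W k) u = u x := by
  obtain ⟨c, rfl⟩ := (Submodule.mem_span_range_iff_exists_fun ℝ).1 hu
  have hc : (∑ i, c i • W i) = fun x => ∑ i, W i x * c i := by
    funext y
    simp [mul_comm]
  rw [hc]
  refine Finset.sum_congr rfl fun k _ => ?_
  rw [ipx_sum (hW k) hW]
  simp [hon]

theorem nv_ne_zero_of_ipv_div {w : (Fin d → ℝ) → ℝ}
    (h : ipv (fun v => w v / nv w) (fun v => w v / nv w) = 1) : nv w ≠ 0 := by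
  intro h0
  simp [h0, ipv] at h

end

/-- with `V_1 = Ṽ_1 = 1/‖1‖`, `V_{1+s} = Ṽ_{1+s} = v_s/‖v_s‖` and
`V_{d+2} = Ṽ_{d+2} = (|v|²−1)/‖|v|²−1‖`, the discrete energy continuity equation
`(e^{n+1} − e^n)/τ + ∇_x·Q^n − E^n·((E^{n+1}−E^n)/τ − j^n) = |E^{n+1}−E^n|²/(2τ)`
holds pointwise. -/
theorem discrete_energy_continuity
    (d r R R' : ℕ) (hd : 0 < d) (hr : d + 2 ≤ r) (hR' : d + 2 ≤ R')
    (τ : ℝ) (hτ : 0 < τ)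
    (S : Fin r → Fin r → ℝ)
    (E E1 : (Fin d → ℝ) → Fin d → ℝ)
    (hEsm : ∀ s, ContDiff ℝ (⊤ : ℕ∞) fun x => E x s)
    (hEper : ∀ s, Per fun x => E x s)
    (hE1sm : ∀ s, ContDiff ℝ (⊤ : ℕ∞) fun x => E1 x s)
    (hE1per : ∀ s, Per fun x => E1 x s)
    (X : Fin r → (Fin d → ℝ) → ℝ)
    (hXsm : ∀ i, ContDiff ℝ (⊤ : ℕ∞) (X i)) (hXper : ∀ i, Per (X i))
    (hXon : ∀ i j, ipx (X i) (X j) = if i = j then (1 : ℝ) else 0)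
    (V : Fin r → (Fin d → ℝ) → ℝ)
    (hVsm : ∀ j, ContDiff ℝ (⊤ : ℕ∞) (V j)) (hVpoly : ∀ j, PolyAll (V j))
    (hVon : ∀ i j, ipv (V i) (V j) = if i = j then (1 : ℝ) else 0)
    (Xt : Fin R → (Fin d → ℝ) → ℝ)
    (hXtsm : ∀ k, ContDiff ℝ (⊤ : ℕ∞) (Xt k)) (hXtper : ∀ k, Per (Xt k))
    (hXton : ∀ k l, ipx (Xt k) (Xt l) = if k = l then (1 : ℝ) else 0)
    (Vt : Fin R' → (Fin d → ℝ) → ℝ)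
    (hVtsm : ∀ l, ContDiff ℝ (⊤ : ℕ∞) (Vt l)) (hVtpoly : ∀ l, PolyAll (Vt l))
    (hVton : ∀ k l, ipv (Vt k) (Vt l) = if k = l then (1 : ℝ) else 0)
    -- the low-rank function f^n and the right-hand side RHS[f^n]
    (fn : (Fin d → ℝ) → (Fin d → ℝ) → ℝ)
    (hfn : fn = fun x v => f0v v * ∑ i, ∑ j, X i x * S i j * V j v)
    (RHS : (Fin d → ℝ) → (Fin d → ℝ) → ℝ)
    (hRHS : RHS = fun x v =>
      -(∑ s, v s * pd s (fun y => fn y v) x) + ∑ s, E x s * pd s (fn x) v)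
    -- the K step: K^{n+1}_k = K^n_k + τ ∫ V_k RHS[f^n] dv
    (K1 : Fin r → (Fin d → ℝ) → ℝ)
    (hK1 : K1 = fun k x => (∑ i, X i x * S i k) + τ * ∫ v, V k v * RHS x v)
    -- the augmented bases contain X_i, ∂_t X_i, K_i^{n+1} and V_j respectively
    (hspanX : ∀ i, X i ∈ Submodule.span ℝ (Set.range Xt))
    (hspanDX : ∀ i t, pd t (X i) ∈ Submodule.span ℝ (Set.range Xt))
    (hspanK : ∀ i, K1 i ∈ Submodule.span ℝ (Set.range Xt))
    (hspanV : ∀ j, V j ∈ Submodule.span ℝ (Set.range Vt))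
    -- the projection matrices M, N^T and the updated coefficients S̃^{n+1}
    (M : Fin R → Fin r → ℝ) (hM : M = fun k i => ipx (Xt k) (X i))
    (NT : Fin r → Fin R' → ℝ) (hNT : NT = fun j l => ipv (V j) (Vt l))
    (St : Fin R → Fin R' → ℝ)
    (hSt : St = fun k l => (∑ i, ∑ j, M k i * S i j * NT j l)
      + τ * ∫ x in cube d, ∫ v, Xt k x * Vt l v * RHS x v)
    -- fixed velocity basis functions 1/‖1‖, v_s/‖v_s‖, (|v|²−1)/‖|v|²−1‖ in V and Ṽ
    (hV1 : V ⟨0, by omega⟩ = fun _ => 1 / nv fun _ : Fin d → ℝ => (1 : ℝ))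
    (hVt1 : Vt ⟨0, by omega⟩ = fun _ => 1 / nv fun _ : Fin d → ℝ => (1 : ℝ))
    (hVs : ∀ s : Fin d, V ⟨s.1 + 1, by have := s.isLt; omega⟩
      = fun v => v s / nv fun v : Fin d → ℝ => v s)
    (hVts : ∀ s : Fin d, Vt ⟨s.1 + 1, by have := s.isLt; omega⟩
      = fun v => v s / nv fun v : Fin d → ℝ => v s)
    (hVd2 : V ⟨d + 1, by omega⟩
      = fun v => ((∑ i, v i ^ 2) - 1) / nv fun v : Fin d → ℝ => (∑ i, v i ^ 2) - 1)
    (hVtd2 : Vt ⟨d + 1, by omega⟩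
      = fun v => ((∑ i, v i ^ 2) - 1) / nv fun v : Fin d → ℝ => (∑ i, v i ^ 2) - 1)
    -- moment j^n, energy densities e^n and e^{n+1}, energy flux Q^n
    (jn : (Fin d → ℝ) → Fin d → ℝ) (hjn : jn = fun x s => ∫ v, v s * fn x v)
    (e e1 : (Fin d → ℝ) → ℝ) (Q : (Fin d → ℝ) → Fin d → ℝ)
    (he : e = fun x =>
      (1 / 2) * (∫ v, (∑ i, v i ^ 2) * fn x v) + (1 / 2) * ∑ i, E x i ^ 2)
    (he1 : e1 = fun x => (1 / 2) *
        ((nv fun v : Fin d → ℝ => (∑ i, v i ^ 2) - 1)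
            * ∑ k, Xt k x * St k ⟨d + 1, by omega⟩
          + (nv fun _ : Fin d → ℝ => (1 : ℝ)) * ∑ k, Xt k x * St k ⟨0, by omega⟩)
      + (1 / 2) * ∑ i, E1 x i ^ 2)
    (hQ : Q = fun x s => (1 / 2) * ∫ v, v s * (∑ i, v i ^ 2) * fn x v) :
    ∀ x, (e1 x - e x) / τ + (∑ s, pd s (fun y => Q y s) x)
        - (∑ s, E x s * ((E1 x s - E x s) / τ - jn x s))
      = (∑ s, (E1 x s - E x s) ^ 2) / (2 * τ) := by
  have hV : ∀ j, PolyGrowth (V j) := fun j => .of_polyAll (hVsm j) (hVpoly j)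
  have hVd : ∀ j, Differentiable ℝ (V j) := fun j => (hVsm j).differentiable (by simp)
  have hV' : ∀ j s, PolyGrowth (pd s (V j)) := fun j s => .pd_of_polyAll (hVsm j) (hVpoly j) s
  have hXd : ∀ i, Differentiable ℝ (X i) := fun i => (hXsm i).differentiable (by simp)
  have hXtc : ∀ k, Continuous (Xt k) := fun k => (hXtsm k).continuous
  have hXc : ∀ i, Continuous (X i) := fun i => (hXsm i).continuous
  set j0 : Fin r := ⟨0, by omega⟩ with hj0
  set j2 : Fin r := ⟨d + 1, by omega⟩ with hj2
  set n0 := nv fun _ : Fin d → ℝ => (1 : ℝ) with hn0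
  set n2 := nv fun v : Fin d → ℝ => (∑ i, v i ^ 2) - 1 with hn2
  have hn0' : n0 ≠ 0 := nv_ne_zero_of_ipv_div (by simpa [hV1] using hVon j0 j0)
  have hn2' : n2 ≠ 0 := nv_ne_zero_of_ipv_div (by simpa [hVd2] using hVon j2 j2)
  obtain ⟨c, hc⟩ : ∃ c : Fin r → (Fin d → ℝ) → ℝ, c = fun j x => ∑ i, X i x * S i j := ⟨_, rfl⟩
  have hcd : ∀ j, Differentiable ℝ (c j) := fun j => by
    simp only [hc]
    exact Differentiable.fun_sum fun i _ => (hXd i).mul_const _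
  have hfn' : ∀ x v, fn x v = f0v v * ∑ j, c j x * V j v := fun x v => by
    simp only [hfn, hc, Finset.sum_mul]
    rw [Finset.sum_comm]
  have hG : ∀ a : Fin r → ℝ, PolyGrowth fun v => ∑ j, a j * V j v := fun a =>
    .sum _ fun j => (PolyGrowth.const (a j)).mul (hV j)
  have hGd : ∀ a : Fin r → ℝ, Differentiable ℝ fun v => ∑ j, a j * V j v := fun a =>
    Differentiable.fun_sum fun j _ => (hVd j).const_mul _
  have hG' : ∀ (a : Fin r → ℝ) s, PolyGrowth (pd s fun v => ∑ j, a j * V j v) := fun a s => by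
    have : (pd s fun v => ∑ j, a j * V j v) = fun v => ∑ j, pd s (V j) v * a j := by
      funext v
      rw [← pd_sum_mul hVd]
      simp only [mul_comm]
    rw [this]
    exact .sum _ fun j => (hV' j s).mul (.const _)
  -- the two partial derivatives of `fn`
  have hdx : ∀ s x v, pd s (fun y => fn y v) x = f0v v * ∑ j, pd s (c j) x * V j v :=
    fun s x v => by
      simp only [hfn']
      rw [pd_const_mul (Differentiable.fun_sum fun j _ => (hcd j).mul_const _), pd_sum_mul hcd]
  have hfnx : ∀ x, fn x = fun v => f0v v * ∑ j, c j x * V j v := fun x => funext (hfn' x)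
  -- splitting of `|v|²` moments along the fixed basis functions
  have hsplit : ∀ h : (Fin d → ℝ) → ℝ, PolyGrowth h →
      ∫ v, (∑ i, v i ^ 2) * (f0v v * h v)
        = n2 * (∫ v, V j2 v * (f0v v * h v)) + n0 * ∫ v, V j0 v * (f0v v * h v) := by
    intro h hh
    rw [← integral_const_mul, ← integral_const_mul,
      ← integral_add (((hV j2).integrable_mul hh).const_mul _)
        (((hV j0).integrable_mul hh).const_mul _)]
    congr 1
    funext v
    rw [hV1, hVd2]
    field_simp
    ring
  have hmom : ∀ k x, ∫ v, V k v * fn x v = c k x := fun k x => by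
    simp only [hfn']
    rw [(hV k).integral_mul_sum hV]
    have : ∀ j, ∫ v, V k v * (f0v v * V j v) = if k = j then 1 else 0 := fun j => by
      rw [← hVon k j, ipv]
      congr 1
      funext v
      ring
    simp [this]
  have hsqfn : ∀ x, ∫ v, (∑ i, v i ^ 2) * fn x v = n2 * c j2 x + n0 * c j0 x := fun x => by
    rw [← hmom, ← hmom]
    simp only [hfn']
    exact hsplit _ (hG _)
  -- the right-hand side is a Gaussian-weighted function of polynomial growth
  have hpdv : ∀ s x v, pd s (fn x) v
      = f0v v * (pd s (fun v => ∑ j, c j x * V j v) v - v s * ∑ j, c j x * V j v) :=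
    fun s x v => by rw [hfnx, pd_f0v_mul (hGd _)]
  have hRHSsq : ∀ x, ∫ v, (∑ i, v i ^ 2) * RHS x v
      = n2 * (∫ v, V j2 v * RHS x v) + n0 * ∫ v, V j0 v * RHS x v := fun x => by
    have hR : ∀ v, RHS x v = f0v v * (-(∑ s, v s * ∑ j, pd s (c j) x * V j v)
        + ∑ s, E x s * (pd s (fun v => ∑ j, c j x * V j v) v - v s * ∑ j, c j x * V j v)) :=
      fun v => by
        simp only [hRHS, hdx, hpdv]
        rw [mul_add, mul_neg, Finset.mul_sum, Finset.mul_sum]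
        congr 2
        · exact Finset.sum_congr rfl fun s _ => by ring
        · funext s
          ring
    simp only [hR]
    exact hsplit _ (.add (.neg (.sum _ fun s => (PolyGrowth.coord s).mul (hG _)))
      (.sum _ fun s => (PolyGrowth.const _).mul
        ((hG' _ s).sub ((PolyGrowth.coord s).mul (hG _)))))
  -- the updated coefficients reproduce the K step for the fixed basis functions
  have hK : ∀ (j : Fin r) (l : Fin R'), Vt l = V j → ∀ x, ∑ k, Xt k x * St k l = K1 j x := by
    intro j l hjl x
    rw [← sum_mul_ipx_of_mem_span hXtc hXton (hspanK j) x]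
    refine Finset.sum_congr rfl fun k _ => ?_
    congr 1
    have hKc : Continuous (K1 j) := continuous_of_mem_span hXtc (hspanK j)
    have hcc : Continuous fun x => ∑ i, X i x * S i j :=
      continuous_finsetSum _ fun i _ => (hXc i).mul_const _
    have hI : Continuous fun x => ∫ v, V j v * RHS x v := by
      have : (fun x => ∫ v, V j v * RHS x v) = fun x => τ⁻¹ * (K1 j x - ∑ i, X i x * S i j) := by
        funext x
        rw [hK1]
        field_simp
        ring
      rw [this]
      exact continuous_const.mul (hKc.sub hcc)
    have : K1 j = fun x => (∑ i, X i x * S i j) + τ * ∫ v, V j v * RHS x v := by rw [hK1]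
    rw [this, ipx_add_const_mul (hXtc k) hcc hI, ipx_sum (hXtc k) hXc]
    simp only [hSt, hM, hNT, hjl, hVon]
    congr 1
    · simp
    · simp only [ipx, mul_assoc, integral_const_mul]
  intro x
  -- the moments of the right-hand side
  have hQd : ∀ s, pd s (fun y => Q y s) x
      = (1 / 2) * ∫ v, (∑ i, v i ^ 2) * (v s * pd s (fun y => fn y v) x) := fun s => by
    have hφ := (PolyGrowth.coord s).mul (PolyGrowth.sq_norm (d := d))
    have hQs : (fun y => Q y s) = fun y => (1 / 2) *
        ∑ j, c j y * ∫ v, v s * (∑ i, v i ^ 2) * (f0v v * V j v) := by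
      funext y
      simp only [hQ, hfn']
      rw [hφ.integral_mul_sum hV]
    rw [hQs, pd_const_mul (Differentiable.fun_sum fun j _ => (hcd j).mul_const _), pd_sum_mul hcd,
      ← hφ.integral_mul_sum hV]
    congr 2
    funext v
    rw [hdx]
    ring
  have hibp : ∀ s, ∫ v, (∑ i, v i ^ 2) * pd s (fn x) v = -(2 * jn x s) := fun s => by
    simp only [hjn, hfnx]
    exact integral_sq_norm_mul_pd (hGd _) (hG _) s (hG' _ s)
  have hflux : ∫ v, (∑ i, v i ^ 2) * RHS x v
      = -(2 * ∑ s, pd s (fun y => Q y s) x) - 2 * ∑ s, E x s * jn x s := by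
    have hi1 : ∀ s, Integrable fun v : Fin d → ℝ =>
        (∑ i, v i ^ 2) * (v s * pd s (fun y => fn y v) x) := fun s => by
      simp only [hdx]
      refine ((PolyGrowth.sq_norm.mul (PolyGrowth.coord s)).integrable_mul
        (hG fun j => pd s (c j) x)).congr (ae_of_all _ fun v => ?_)
      ring
    have hi2 : ∀ s, Integrable fun v : Fin d → ℝ =>
        E x s * ((∑ i, v i ^ 2) * pd s (fn x) v) := fun s => by
      simp only [hpdv]
      exact (PolyGrowth.sq_norm.integrable_mul
        ((hG' _ s).sub ((PolyGrowth.coord s).mul (hG _)))).const_mul _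
    have hexpand : (fun v => (∑ i, v i ^ 2) * RHS x v) = fun v : Fin d → ℝ =>
        -(∑ s, (∑ i, v i ^ 2) * (v s * pd s (fun y => fn y v) x))
          + ∑ s, E x s * ((∑ i, v i ^ 2) * pd s (fn x) v) := by
      funext v
      simp only [hRHS]
      rw [mul_add, mul_neg, Finset.mul_sum, Finset.mul_sum]
      congr 1
      exact Finset.sum_congr rfl fun s _ => by ring
    have hneg : Integrable fun v : Fin d → ℝ =>
        -(∑ s, (∑ i, v i ^ 2) * (v s * pd s (fun y => fn y v) x)) :=
      (integrable_finsetSum _ fun s _ => hi1 s).neg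
    rw [hexpand, integral_add hneg
      (integrable_finsetSum _ fun s _ => hi2 s), integral_neg,
      integral_finsetSum _ fun s _ => hi1 s, integral_finsetSum _ fun s _ => hi2 s]
    simp only [integral_const_mul, hibp, hQd]
    rw [Finset.mul_sum, Finset.mul_sum, sub_eq_add_neg]
    simp only [← Finset.sum_neg_distrib, ← Finset.sum_add_distrib]
    exact Finset.sum_congr rfl fun s _ => by ring
  have hK2 := hK j2 _ (hVtd2.trans hVd2.symm) x
  have hK0 := hK j0 _ (hVt1.trans hV1.symm) x
  have hK1x : ∀ j, K1 j x = c j x + τ * ∫ v, V j v * RHS x v := fun j => by rw [hK1, hc]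
  have he1x : e1 x = (1 / 2) * ((∫ v, (∑ i, v i ^ 2) * fn x v)
      + τ * ∫ v, (∑ i, v i ^ 2) * RHS x v) + (1 / 2) * ∑ i, E1 x i ^ 2 := by
    rw [he1]
    simp only [hK2, hK0, hK1x, hsqfn, hRHSsq]
    ring
  have hex : e x = (1 / 2) * (∫ v, (∑ i, v i ^ 2) * fn x v) + (1 / 2) * ∑ i, E x i ^ 2 := by
    rw [he]
  have hwork : ∑ s, E x s * ((E1 x s - E x s) / τ - jn x s)
      = (∑ s, E x s * (E1 x s - E x s)) / τ - ∑ s, E x s * jn x s := by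
    rw [Finset.sum_div, ← Finset.sum_sub_distrib]
    exact Finset.sum_congr rfl fun s _ => by ring
  have hsq : ∑ s, (E1 x s - E x s) ^ 2
      = (∑ s, E1 x s ^ 2) - (∑ s, E x s ^ 2) - 2 * ∑ s, E x s * (E1 x s - E x s) := by
    rw [Finset.mul_sum, ← Finset.sum_sub_distrib, ← Finset.sum_sub_distrib]
    exact Finset.sum_congr rfl fun s _ => by ring
  rw [hwork, hsq, he1x, hex, hflux]
  field_simp
  ring
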